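/- arXiv:1212.3689 — 6 statements merged into one kernel-verified Lean document; each statement's English description precedes it below -/
import Mathlib

section
/- Let W be a discrete memoryless channel with finite input alphabet X and finite output alphabet Y such that V_min = 0 and V_max > 0, and let ε = 1/2. Then there exists a constant K ∈ ℝ such that for all n ≥ 1, log M*(W^n, 1/2) ≤ n·C + (1/2)·log n + K, where C is the capacity of W. -/
open Finset MeasureTheory

/-- `P` is a probability distribution on the finite set `Z`. -/
def IsDist {Z : Type*} [Fintype Z] (P : Z → ℝ) : Prop :=
  (∀ z, 0 ≤ P z) ∧ ∑ z, P z = 1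

/-- `W` is a (discrete memoryless) channel from `X` to `Y`: a stochastic matrix. -/
def IsChannel {X Y : Type*} [Fintype X] [Fintype Y] (W : X → Y → ℝ) : Prop :=
  ∀ x, IsDist (W x)

/-- Relative entropy `D(P‖Q) = Σ_z P(z) log (P(z)/Q(z))`. -/
noncomputable def relEnt {Z : Type*} [Fintype Z] (P Q : Z → ℝ) : ℝ :=
  ∑ z, P z * Real.log (P z / Q z)

/-- Divergence variance `V(P‖Q)`. -/
noncomputable def divVar {Z : Type*} [Fintype Z] (P Q : Z → ℝ) : ℝ :=
  ∑ z, P z * (Real.log (P z / Q z) - relEnt P Q) ^ 2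

/-- Output distribution `PW`. -/
noncomputable def outDist {X Y : Type*} [Fintype X] (P : X → ℝ) (W : X → Y → ℝ) (y : Y) : ℝ :=
  ∑ x, P x * W x y

/-- Mutual information `I(P,W) = Σ_x P(x) D(W(·|x)‖PW)`. -/
noncomputable def mutInfo {X Y : Type*} [Fintype X] [Fintype Y] (P : X → ℝ) (W : X → Y → ℝ) : ℝ :=
  ∑ x, P x * relEnt (W x) (outDist P W)

/-- Channel capacity `C = max_P I(P,W)`. -/
noncomputable def capacity {X Y : Type*} [Fintype X] [Fintype Y] (W : X → Y → ℝ) : ℝ :=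
  sSup {c : ℝ | ∃ P : X → ℝ, IsDist P ∧ c = mutInfo P W}

/-- `P` is a capacity-achieving input distribution (member of `Π`). -/
def isCAID {X Y : Type*} [Fintype X] [Fintype Y] (W : X → Y → ℝ) (P : X → ℝ) : Prop :=
  IsDist P ∧ mutInfo P W = capacity W

/-- Conditional information variance `V(P,W) = Σ_x P(x) V(W(·|x)‖PW)`. -/
noncomputable def infoVar {X Y : Type*} [Fintype X] [Fintype Y] (P : X → ℝ) (W : X → Y → ℝ) : ℝ :=
  ∑ x, P x * divVar (W x) (outDist P W)

/-- `V_min = min_{P ∈ Π} V(P,W)`. -/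
noncomputable def Vmin {X Y : Type*} [Fintype X] [Fintype Y] (W : X → Y → ℝ) : ℝ :=
  sInf {v : ℝ | ∃ P : X → ℝ, isCAID W P ∧ v = infoVar P W}

/-- `V_max = max_{P ∈ Π} V(P,W)`. -/
noncomputable def Vmax {X Y : Type*} [Fintype X] [Fintype Y] (W : X → Y → ℝ) : ℝ :=
  sSup {v : ℝ | ∃ P : X → ℝ, isCAID W P ∧ v = infoVar P W}

/-- The `ε`-channel dispersion `V_ε`. -/
noncomputable def Veps {X Y : Type*} [Fintype X] [Fintype Y] (W : X → Y → ℝ) (ε : ℝ) : ℝ :=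
  if ε < 1/2 then Vmin W else Vmax W

/-- Average error probability of the code `(e, d)` with `M` messages for channel `V`. -/
noncomputable def avgErr {A B : Type*} [Fintype B] {M : ℕ} (V : A → B → ℝ)
    (e : Fin M → A) (d : B → Fin M) : ℝ :=
  1 - (1 / (M : ℝ)) * ∑ m : Fin M, ∑ b ∈ Finset.univ.filter (fun b => d b = m), V (e m) b

/-- `M*(V,ε)`: the largest number of messages of a code with average error probability `≤ ε`. -/
noncomputable def Mstar {A B : Type*} [Fintype B] (V : A → B → ℝ) (ε : ℝ) : ℕ :=
  sSup {M : ℕ | ∃ e : Fin M → A, ∃ d : B → Fin M, avgErr V e d ≤ ε}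

/-- The Gaussian tail integral, without normalisation. -/
noncomputable def gaussTail (x : ℝ) : ℝ := ∫ t in Set.Ioi x, Real.exp (-(1 / 2) * t ^ 2)

/-- The Mills ratio of the standard Gaussian. -/
noncomputable def mills (x : ℝ) : ℝ := Real.exp (1 / 2 * x ^ 2) * gaussTail x

theorem integrable_gauss : Integrable (fun t : ℝ => Real.exp (-(1 / 2) * t ^ 2)) :=
  integrable_exp_neg_mul_sq (by norm_num)

theorem hasDerivAt_gaussTail (x : ℝ) :
    HasDerivAt gaussTail (-Real.exp (-(1 / 2) * x ^ 2)) x := by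
  have h : gaussTail = fun x => gaussTail 0 - ∫ t in (0 : ℝ)..x, Real.exp (-(1 / 2) * t ^ 2) := by
    funext x
    rw [eq_sub_iff_add_eq', gaussTail, gaussTail]
    exact intervalIntegral.integral_interval_add_Ioi integrable_gauss.integrableOn
      integrable_gauss.integrableOn
  rw [h]
  have hc : Continuous fun t : ℝ => Real.exp (-(1 / 2) * t ^ 2) := by fun_prop
  exact (intervalIntegral.integral_hasDerivAt_right (hc.intervalIntegrable _ _)
    hc.stronglyMeasurable.stronglyMeasurableAtFilter hc.continuousAt).const_sub _

theorem hasDerivAt_mills (x : ℝ) : HasDerivAt mills (x * mills x - 1) x := by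
  have h1 : HasDerivAt (fun x : ℝ => Real.exp (1 / 2 * x ^ 2))
      (Real.exp (1 / 2 * x ^ 2) * (1 / 2 * (2 * x))) x := by
    have := ((hasDerivAt_pow 2 x).const_mul (1 / 2 : ℝ)).exp
    simpa using this
  have h2 := h1.mul (hasDerivAt_gaussTail x)
  refine h2.congr_deriv ?_
  have h3 : Real.exp (1 / 2 * x ^ 2) * Real.exp (-(1 / 2) * x ^ 2) = 1 := by
    rw [← Real.exp_add]; ring_nf; simp
  rw [mul_neg, h3, mills]; ring

theorem mills_nonneg (x : ℝ) : 0 ≤ mills x :=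
  mul_nonneg (Real.exp_pos _).le (integral_nonneg fun _ => (Real.exp_pos _).le)

theorem mul_mills_le_one (x : ℝ) : x * mills x ≤ 1 := by
  rcases le_or_gt x 0 with hx | hx
  · nlinarith [mills_nonneg x]
  have hi : Integrable fun t : ℝ => t * Real.exp (-(1 / 2) * t ^ 2) :=
    integrable_mul_exp_neg_mul_sq (by norm_num)
  have hd : ∀ t ∈ Set.Ici x, HasDerivAt (fun t : ℝ => -Real.exp (-(1 / 2) * t ^ 2))
      (t * Real.exp (-(1 / 2) * t ^ 2)) t := fun t _ => by
    have := (((hasDerivAt_pow 2 t).const_mul (-(1 / 2) : ℝ)).exp).neg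
    refine this.congr_deriv ?_
    simp; ring
  have hlim : Filter.Tendsto (fun t : ℝ => -Real.exp (-(1 / 2) * t ^ 2)) Filter.atTop
      (nhds (-0)) := by
    refine (Real.tendsto_exp_atBot.comp ?_).neg
    exact (Filter.tendsto_pow_atTop (two_ne_zero)).const_mul_atTop_of_neg (by norm_num)
  have h1 := integral_Ioi_of_hasDerivAt_of_tendsto' hd hi.integrableOn hlim
  have h2 : x * gaussTail x ≤ Real.exp (-(1 / 2) * x ^ 2) := by
    calc x * gaussTail x = ∫ t in Set.Ioi x, x * Real.exp (-(1 / 2) * t ^ 2) := by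
          rw [gaussTail, integral_const_mul]
      _ ≤ ∫ t in Set.Ioi x, t * Real.exp (-(1 / 2) * t ^ 2) :=
          setIntegral_mono_on (integrable_gauss.const_mul x).integrableOn hi.integrableOn
            measurableSet_Ioi fun t ht =>
              mul_le_mul_of_nonneg_right (le_of_lt ht) (Real.exp_pos _).le
      _ = _ := by rw [h1]; simp
  calc x * mills x = Real.exp (1 / 2 * x ^ 2) * (x * gaussTail x) := by rw [mills]; ring
    _ ≤ Real.exp (1 / 2 * x ^ 2) * Real.exp (-(1 / 2) * x ^ 2) := by gcongr
    _ = 1 := by rw [← Real.exp_add]; ring_nf; simp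

theorem antitone_mills : Antitone mills :=
  antitone_of_hasDerivAt_nonpos hasDerivAt_mills
    fun x => by have := mul_mills_le_one x; simp; linarith

/-- The solution of the Stein equation `f' x - x f x = 1_{x ≤ k} - p`, where `q = 1 - p`
and `p * mills k = q * mills (-k)`. -/
noncomputable def steinSol (p q k x : ℝ) : ℝ :=
  if x ≤ k then q * mills (-x) else p * mills x

/-- The derivative of `steinSol p q k`, as prescribed by the Stein equation. -/
noncomputable def steinDeriv (p q k x : ℝ) : ℝ :=
  x * steinSol p q k x + (if x ≤ k then 1 else 0) - p

theorem steinSol_of_ge {p q k x : ℝ} (h : p * mills k = q * mills (-k)) (hx : k ≤ x) :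
    steinSol p q k x = p * mills x := by
  rcases hx.eq_or_lt with rfl | hx
  · simp [steinSol, h]
  · simp [steinSol, not_le.2 hx]

theorem exists_steinSol_sub_eq_left {p q k a b : ℝ} (hpq : p + q = 1) (hab : a < b) (hb : b ≤ k) :
    ∃ u ∈ Set.Ioo a b, steinSol p q k b - steinSol p q k a = steinDeriv p q k u * (b - a) := by
  have hd : ∀ x, HasDerivAt (fun x => q * mills (-x)) (q * (x * mills (-x) + 1)) x := fun x => by
    have := ((hasDerivAt_mills (-x)).comp x (hasDerivAt_neg x)).const_mul q
    exact this.congr_deriv (by ring)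
  obtain ⟨u, hu, h⟩ := exists_hasDerivAt_eq_slope (fun x => q * mills (-x)) _ hab
    (fun x _ => (hd x).continuousAt.continuousWithinAt) fun x _ => hd x
  refine ⟨u, hu, ?_⟩
  have hu' : u ≤ k := hu.2.le.trans hb
  have hba : b - a ≠ 0 := (sub_pos.2 hab).ne'
  rw [eq_div_iff hba] at h
  simp only [steinDeriv, steinSol, hb, hab.le.trans hb, hu', if_true]
  rw [← h, show p = 1 - q by linarith]; ring

theorem exists_steinSol_sub_eq_right {p q k a b : ℝ} (h : p * mills k = q * mills (-k))
    (hab : a < b) (ha : k ≤ a) :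
    ∃ u ∈ Set.Ioo a b, steinSol p q k b - steinSol p q k a = steinDeriv p q k u * (b - a) := by
  have hd : ∀ x, HasDerivAt (fun x => p * mills x) (p * (x * mills x - 1)) x :=
    fun x => (hasDerivAt_mills x).const_mul p
  obtain ⟨u, hu, h'⟩ := exists_hasDerivAt_eq_slope (fun x => p * mills x) _ hab
    (fun x _ => (hd x).continuousAt.continuousWithinAt) fun x _ => hd x
  refine ⟨u, hu, ?_⟩
  have hu' : k < u := ha.trans_lt hu.1
  have hba : b - a ≠ 0 := (sub_pos.2 hab).ne'
  rw [eq_div_iff hba] at h'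
  rw [steinDeriv, steinSol_of_ge h ha, steinSol_of_ge h (ha.trans hab.le),
    steinSol_of_ge h hu'.le, if_neg (not_le.2 hu'), ← h']
  ring

theorem steinSol_sub_mem {p q k a b l m : ℝ} (hpq : p + q = 1) (h : p * mills k = q * mills (-k))
    (hab : a ≤ b) (hlm : ∀ u ∈ Set.Icc a b, l ≤ steinDeriv p q k u ∧ steinDeriv p q k u ≤ m) :
    l * (b - a) ≤ steinSol p q k b - steinSol p q k a ∧
      steinSol p q k b - steinSol p q k a ≤ m * (b - a) := by
  have key : ∀ c d, a ≤ c → c ≤ d → d ≤ b → (d ≤ k ∨ k ≤ c) →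
      l * (d - c) ≤ steinSol p q k d - steinSol p q k c ∧
      steinSol p q k d - steinSol p q k c ≤ m * (d - c) := by
    intro c d hac hcd hdb hk
    rcases hcd.eq_or_lt with rfl | hcd
    · simp
    have : ∃ u ∈ Set.Ioo c d,
        steinSol p q k d - steinSol p q k c = steinDeriv p q k u * (d - c) := by
      rcases hk with hk | hk
      · exact exists_steinSol_sub_eq_left hpq hcd hk
      · exact exists_steinSol_sub_eq_right h hcd hk
    obtain ⟨u, hu, hE⟩ := this
    obtain ⟨h1, h2⟩ := hlm u ⟨hac.trans hu.1.le, hu.2.le.trans hdb⟩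
    rw [hE]
    have : 0 ≤ d - c := (sub_pos.2 hcd).le
    exact ⟨by gcongr, by gcongr⟩
  by_cases hbk : b ≤ k
  · exact key a b le_rfl hab le_rfl (.inl hbk)
  by_cases hka : k ≤ a
  · exact key a b le_rfl hab le_rfl (.inr hka)
  have h1 := key a k le_rfl (not_le.1 hka).le (not_le.1 hbk).le (.inl le_rfl)
  have h2 := key k b (not_le.1 hka).le (not_le.1 hbk).le le_rfl (.inr le_rfl)
  constructor <;> linarith [h1.1, h1.2, h2.1, h2.2]

theorem abs_steinDeriv_le {p q k : ℝ} (hp : 0 ≤ p) (hq : 0 ≤ q) (hpq : p + q = 1) (hk0 : 0 ≤ k)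
    (hk1 : k ≤ 1) (x : ℝ) : |steinDeriv p q k x| ≤ 1 + mills (-1) := by
  have hm := mills_nonneg (-1)
  rw [steinDeriv, steinSol, abs_le]
  split_ifs with hx
  · have h1 := mul_mills_le_one (-x)
    have h2 : x * mills (-x) ≤ mills (-1) := by
      rcases le_total x 0 with h0 | h0
      · nlinarith [mills_nonneg (-x)]
      · have := antitone_mills (show (-1 : ℝ) ≤ -x by linarith)
        nlinarith [mills_nonneg (-x)]
    constructor <;> nlinarith
  · have h1 := mul_mills_le_one x
    have h2 : 0 ≤ x * mills x := mul_nonneg (by linarith) (mills_nonneg x)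
    constructor <;> nlinarith

theorem abs_steinSol_le {p q k : ℝ} (hp : 0 ≤ p) (hq : 0 ≤ q) (hpq : p + q = 1) (hk0 : 0 ≤ k)
    (hk1 : k ≤ 1) (x : ℝ) : |steinSol p q k x| ≤ mills (-1) := by
  have hm := mills_nonneg (-1)
  rw [steinSol]
  split_ifs with hx
  · rw [abs_of_nonneg (mul_nonneg hq (mills_nonneg _))]
    have := antitone_mills (show (-1 : ℝ) ≤ -x by linarith)
    nlinarith [mills_nonneg (-x)]
  · rw [abs_of_nonneg (mul_nonneg hp (mills_nonneg _))]
    have := antitone_mills (show (-1 : ℝ) ≤ x by linarith)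
    nlinarith [mills_nonneg x]

theorem mills_sub_mills_neg_ge {k : ℝ} (hk : 0 ≤ k) : k ≤ mills (-k) - mills k := by
  have h1 : mills k ≤ mills 0 := antitone_mills hk
  rcases hk.eq_or_lt with rfl | hk
  · simp
  obtain ⟨u, hu, h⟩ := exists_hasDerivAt_eq_slope mills _ (neg_lt_zero.2 hk)
    (fun x _ => (hasDerivAt_mills x).continuousAt.continuousWithinAt)
    fun x _ => hasDerivAt_mills x
  have h2 : u * mills u ≤ 0 := mul_nonpos_of_nonpos_of_nonneg hu.2.le (mills_nonneg u)
  rw [eq_div_iff (by simpa using hk.ne')] at h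
  nlinarith

theorem mills_pos (x : ℝ) : 0 < mills x := by
  refine (mills_nonneg x).lt_of_ne fun h => ?_
  have hmin : IsLocalMin mills x := Filter.Eventually.of_forall fun y => h ▸ mills_nonneg y
  have := hmin.hasDerivAt_eq_zero (hasDerivAt_mills x)
  simp [← h] at this

/-- Solutions of the Stein equation, with bounds uniform in the threshold `k ∈ [0, 1]`. -/
theorem exists_steinSol : ∃ r c : ℝ, 0 < r ∧ 0 < c ∧ ∀ k : ℝ, 0 ≤ k → k ≤ 1 →
    ∃ (f : ℝ → ℝ) (p : ℝ), 1 / 2 + c * k ≤ p ∧ (∀ x, |f x| ≤ r) ∧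
      (∀ x y, |f y - f x| ≤ r * |y - x|) ∧
      ∀ a b m : ℝ, a ≤ b → (∀ u ∈ Set.Icc a b, u * f u + (if u ≤ k then 1 else 0) - p ≤ m) →
        f b - f a ≤ m * (b - a) := by
  have hm1 : 1 ≤ mills (-1) := by
    have := mills_sub_mills_neg_ge zero_le_one
    linarith [mills_nonneg 1]
  refine ⟨1 + mills (-1), 1 / (4 * mills (-1)), by linarith, by positivity, fun k hk0 hk1 => ?_⟩
  have hsub := mills_sub_mills_neg_ge hk0
  have hle : mills (-k) ≤ mills (-1) := antitone_mills (by linarith)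
  have hk := mills_nonneg k
  have hnk := mills_pos (-k)
  set s := mills k + mills (-k) with hs
  have hs0 : 0 < s := by linarith
  have hp : 0 ≤ mills (-k) / s := by positivity
  have hq : 0 ≤ mills k / s := by positivity
  have hpq : mills (-k) / s + mills k / s = 1 := by field_simp; linarith
  have heq : mills (-k) / s * mills k = mills k / s * mills (-k) := by ring
  refine ⟨steinSol (mills (-k) / s) (mills k / s) k, mills (-k) / s, ?_, fun x => ?_,
    fun x y => ?_, fun a b m hab h => ?_⟩
  · rw [le_div_iff₀ hs0]
    have h1 : 1 / (4 * mills (-1)) * k * s ≤ k / 2 := by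
      rw [one_div, mul_assoc, inv_mul_le_iff₀ (by positivity)]
      have : k * s ≤ k * (2 * mills (-1)) := by gcongr; linarith
      linarith
    linarith
  · exact (abs_steinSol_le hp hq hpq hk0 hk1 x).trans (by linarith)
  · wlog hxy : x ≤ y generalizing x y
    · rw [abs_sub_comm, abs_sub_comm y]; exact this y x (le_of_not_ge hxy)
    have := steinSol_sub_mem (l := -(1 + mills (-1))) (m := 1 + mills (-1)) hpq heq hxy
      fun u _ => abs_le.1 (abs_steinDeriv_le hp hq hpq hk0 hk1 u)
    rw [abs_of_nonneg (sub_nonneg.2 hxy), abs_le]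
    constructor <;> linarith [this.1, this.2]
  · exact (steinSol_sub_mem (l := -(1 + mills (-1))) hpq heq hab
      fun u hu => ⟨(abs_le.1 (abs_steinDeriv_le hp hq hpq hk0 hk1 u)).1, h u hu⟩).2

/-- Expectation of `Φ` under the product distribution with marginals `w i`. -/
noncomputable def prodExp {ι Y : Type*} [Fintype ι] [DecidableEq ι] [Fintype Y]
    (w : ι → Y → ℝ) (Φ : (ι → Y) → ℝ) : ℝ :=
  ∑ y, (∏ i, w i (y i)) * Φ y

section ProdExp

variable {ι Y : Type*} [Fintype ι] [DecidableEq ι] [Fintype Y] {w : ι → Y → ℝ}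

theorem sum_prod_eq_one (hw : ∀ i, IsDist (w i)) : ∑ y : ι → Y, ∏ i, w i (y i) = 1 := by
  rw [← Fintype.piFinset_univ, ← Finset.prod_univ_sum]
  exact Finset.prod_eq_one fun i _ => (hw i).2

theorem prodExp_mono (hw : ∀ i, IsDist (w i)) {Φ Ψ : (ι → Y) → ℝ} (h : ∀ y, Φ y ≤ Ψ y) :
    prodExp w Φ ≤ prodExp w Ψ :=
  Finset.sum_le_sum fun y _ =>
    mul_le_mul_of_nonneg_left (h y) (Finset.prod_nonneg fun i _ => (hw i).1 _)

theorem prodExp_const (hw : ∀ i, IsDist (w i)) (c : ℝ) :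
    prodExp w (fun _ : ι → Y => c) = c := by
  rw [prodExp, ← Finset.sum_mul, sum_prod_eq_one hw, one_mul]

theorem prodExp_add (Φ Ψ : (ι → Y) → ℝ) :
    prodExp w (fun y => Φ y + Ψ y) = prodExp w Φ + prodExp w Ψ := by
  simp [prodExp, mul_add, Finset.sum_add_distrib]

theorem prodExp_const_mul (c : ℝ) (Φ : (ι → Y) → ℝ) :
    prodExp w (fun y => c * Φ y) = c * prodExp w Φ := by
  rw [prodExp, prodExp, Finset.mul_sum]
  exact Finset.sum_congr rfl fun y _ => by ring

theorem prodExp_finset_sum {κ : Type*} (s : Finset κ) (Φ : κ → (ι → Y) → ℝ) :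
    prodExp w (fun y => ∑ j ∈ s, Φ j y) = ∑ j ∈ s, prodExp w (Φ j) := by
  simp only [prodExp, Finset.mul_sum]
  exact Finset.sum_comm

/-- Resampling one coordinate does not change the expectation. -/
theorem prodExp_resample (hw : ∀ i, IsDist (w i)) (i : ι) (Φ : (ι → Y) → ℝ) :
    prodExp w Φ = prodExp w (fun y => ∑ z, w i z * Φ (Function.update y i z)) := by
  have hswap : ∑ a : (ι → Y) × Y, (∏ j, w j (a.1 j)) * (w i a.2 * Φ (Function.update a.1 i a.2)) =
      ∑ a : (ι → Y) × Y, (∏ j, w j (a.1 j)) * (w i a.2 * Φ a.1) := by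
    have hinv : Function.Involutive
        (fun a : (ι → Y) × Y => ((Function.update a.1 i a.2, a.1 i) : (ι → Y) × Y)) := by
      rintro ⟨y, z⟩; simp
    refine Fintype.sum_equiv hinv.toPerm _ _ ?_
    rintro ⟨y, z⟩
    simp only [Function.Involutive.coe_toPerm]
    have h1 : (∏ j, w j (y j)) = w i (y i) * ∏ j ∈ univ.erase i, w j (y j) :=
      (Finset.mul_prod_erase _ _ (mem_univ i)).symm
    have h2 : (∏ j, w j (Function.update y i z j)) = w i z * ∏ j ∈ univ.erase i, w j (y j) := by
      rw [← Finset.mul_prod_erase _ _ (mem_univ i), Function.update_self]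
      congr 1
      exact Finset.prod_congr rfl fun j hj => by
        rw [Function.update_of_ne (Finset.ne_of_mem_erase hj)]
    rw [h1, h2]; ring
  simp only [Fintype.sum_prod_type, ← Finset.mul_sum, ← Finset.sum_mul, (hw i).2, one_mul] at hswap
  exact hswap.symm

variable {X : ι → Y → ℝ}

/-- Stein-type inequality: if all increments of `f` of size at most `b` close to `s` have slope at
most `H s`, then `E[S f(S)] ≤ Var(S) E[H(S)]` for a sum `S` of independent centred variables
bounded by `b`. -/
theorem prodExp_sum_mul_le (hw : ∀ i, IsDist (w i)) (hmean : ∀ i, ∑ z, w i z * X i z = 0)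
    {b : ℝ} (hb : ∀ i z, |X i z| ≤ b) (f H : ℝ → ℝ)
    (hfH : ∀ T x s : ℝ, |x| ≤ b → |T - s| ≤ b → x * (f (T + x) - f T) ≤ x ^ 2 * H s) :
    prodExp w (fun y => (∑ i, X i (y i)) * f (∑ i, X i (y i))) ≤
      (∑ i, ∑ z, w i z * X i z ^ 2) * prodExp w (fun y => H (∑ i, X i (y i))) := by
  simp only [Finset.sum_mul]
  rw [prodExp_finset_sum]
  refine Finset.sum_le_sum fun i _ => ?_
  rw [prodExp_resample hw i, ← Finset.sum_mul, ← prodExp_const_mul]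
  refine prodExp_mono hw fun y => ?_
  rw [Finset.sum_mul]
  set S := ∑ j, X j (y j) with hS
  have hupd : ∀ z, ∑ j, X j (Function.update y i z j) = S - X i (y i) + X i z := fun z => by
    rw [hS, ← Finset.add_sum_erase _ _ (mem_univ i), ← Finset.add_sum_erase _ _ (mem_univ i),
      Function.update_self, Finset.sum_congr rfl fun j hj => by
        rw [Function.update_of_ne (Finset.ne_of_mem_erase hj)]]
    ring
  simp only [hupd, Function.update_self]
  have h0 : ∑ z, w i z * (X i z * f (S - X i (y i) + X i z)) =
      ∑ z, w i z * (X i z * (f (S - X i (y i) + X i z) - f (S - X i (y i)))) := by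
    have : ∑ z, w i z * X i z * f (S - X i (y i)) = 0 := by
      rw [← Finset.sum_mul, hmean, zero_mul]
    rw [← sub_zero (∑ z, w i z * (X i z * f (S - X i (y i) + X i z))), ← this,
      ← Finset.sum_sub_distrib]
    exact Finset.sum_congr rfl fun z _ => by ring
  rw [h0]
  refine Finset.sum_le_sum fun z _ => ?_
  rw [mul_assoc]
  refine mul_le_mul_of_nonneg_left (hfH _ _ _ (hb i z) ?_) ((hw i).1 z)
  simpa using hb i (y i)

theorem prodExp_sum_sq_le (hw : ∀ i, IsDist (w i)) (hmean : ∀ i, ∑ z, w i z * X i z = 0)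
    {b : ℝ} (hb : ∀ i z, |X i z| ≤ b) :
    prodExp w (fun y => (∑ i, X i (y i)) ^ 2) ≤ ∑ i, ∑ z, w i z * X i z ^ 2 := by
  have := prodExp_sum_mul_le hw hmean hb id (fun _ => 1) fun T x s _ _ => by
    simp only [id]; nlinarith
  simpa [prodExp_const hw, pow_two] using this

/-- A solution of the Stein equation at threshold `k` bounds from below the probability that a
normalised sum of independent bounded variables is at most slightly above `k`. -/
theorem sub_le_prodExp_sum_le (hw : ∀ i, IsDist (w i)) (hmean : ∀ i, ∑ z, w i z * X i z = 0)
    {b : ℝ} (hb0 : 0 ≤ b) (hb : ∀ i z, |X i z| ≤ b) (hvar : ∑ i, ∑ z, w i z * X i z ^ 2 = 1)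
    {f : ℝ → ℝ} {p r k : ℝ} (hr : 0 ≤ r) (hf : ∀ x, |f x| ≤ r)
    (hlip : ∀ x y, |f y - f x| ≤ r * |y - x|)
    (hslope : ∀ a b m : ℝ, a ≤ b →
      (∀ u ∈ Set.Icc a b, u * f u + (if u ≤ k then 1 else 0) - p ≤ m) → f b - f a ≤ m * (b - a)) :
    p - 4 * (r * b) ≤ prodExp w (fun y => if ∑ i, X i (y i) ≤ k + 2 * b then 1 else 0) := by
  have hH : ∀ u s : ℝ, |u - s| ≤ 2 * b → u * f u + (if u ≤ k then 1 else 0) - p ≤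
      s * f s + ((if s ≤ k + 2 * b then 1 else 0) + (r * b * s ^ 2 + (3 * (r * b) - p))) := by
    intro u s hus
    have h1 : (if u ≤ k then (1 : ℝ) else 0) ≤ if s ≤ k + 2 * b then 1 else 0 := by
      have := (abs_le.1 hus).1
      split_ifs <;> linarith
    have h2 : (u - s) * f u ≤ 2 * b * r := by
      calc (u - s) * f u ≤ |(u - s) * f u| := le_abs_self _
        _ = |u - s| * |f u| := abs_mul _ _
        _ ≤ 2 * b * r := by gcongr; exact hf u
    have h3 : s * (f u - f s) ≤ r * b * (1 + s ^ 2) := by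
      have hs : 2 * |s| ≤ 1 + s ^ 2 := by nlinarith [sq_nonneg (|s| - 1), sq_abs s]
      calc s * (f u - f s) ≤ |s * (f u - f s)| := le_abs_self _
        _ = |s| * |f u - f s| := abs_mul _ _
        _ ≤ |s| * (r * (2 * b)) := by gcongr; exact (hlip s u).trans (by gcongr)
        _ = r * b * (2 * |s|) := by ring
        _ ≤ _ := by gcongr
    nlinarith
  have key := prodExp_sum_mul_le hw hmean hb f (fun s => s * f s +
    ((if s ≤ k + 2 * b then 1 else 0) + (r * b * s ^ 2 + (3 * (r * b) - p)))) ?_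
  · have hsq := prodExp_sum_sq_le hw hmean hb
    rw [hvar] at hsq key
    rw [one_mul, prodExp_add, prodExp_add, prodExp_add, prodExp_const_mul, prodExp_const hw] at key
    have := mul_le_mul_of_nonneg_left hsq (mul_nonneg hr hb0)
    linarith
  · intro T x s hx hT
    have hx' := abs_le.1 hx
    have hT' := abs_le.1 hT
    rcases le_total 0 x with h0 | h0
    · have := hslope T (T + x) _ (by linarith) fun u hu => hH u s
        (abs_le.2 ⟨by linarith [hu.1], by linarith [hu.2]⟩)
      nlinarith
    · have := hslope (T + x) T _ (by linarith) fun u hu => hH u s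
        (abs_le.2 ⟨by linarith [hu.1], by linarith [hu.2]⟩)
      nlinarith

end ProdExp

/-- A sum of `n` independent centred variables bounded by `B` stays below a constant `K` with
probability exceeding one half by a multiple of `1 / √n`. -/
theorem exists_half_add_le_prodExp_sum_le (Y : Type*) [Fintype Y] {B : ℝ} (hB : 0 < B) :
    ∃ K : ℝ, ∀ n : ℕ, 1 ≤ n → ∀ w X : Fin n → Y → ℝ, (∀ i, IsDist (w i)) →
      (∀ i, ∑ z, w i z * X i z = 0) → (∀ i z, |X i z| ≤ B) →
      1 / 2 + 1 / (4 * √n) ≤ prodExp w (fun y => if ∑ i, X i (y i) ≤ K then 1 else 0) := by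
  obtain ⟨r, c, hr, hc, hstein⟩ := exists_steinSol
  set K₀ := (4 * r * B + B) / c with hK₀
  have hK₀pos : 0 < K₀ := by positivity
  refine ⟨2 * K₀ + 2 * B, fun n hn w X hw hmean hb => ?_⟩
  have hn' : (1 : ℝ) ≤ √n := by
    rw [Real.one_le_sqrt]; exact_mod_cast hn
  have hn0 : 1 / (4 * √n) ≤ 1 / 4 := by
    apply one_div_le_one_div_of_le <;> linarith
  set V := ∑ i, ∑ z, w i z * X i z ^ 2 with hV
  have hV0 : 0 ≤ V := Finset.sum_nonneg fun i _ => Finset.sum_nonneg fun z _ =>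
    mul_nonneg ((hw i).1 z) (sq_nonneg _)
  have hVB : V ≤ n * B ^ 2 := by
    calc V ≤ ∑ i : Fin n, ∑ z, w i z * B ^ 2 := by
          refine Finset.sum_le_sum fun i _ => Finset.sum_le_sum fun z _ => ?_
          exact mul_le_mul_of_nonneg_left (sq_le_sq.2 (by rw [abs_of_pos hB]; exact hb i z))
            ((hw i).1 z)
      _ = n * B ^ 2 := by simp [← Finset.sum_mul, (hw _).2]
  rcases lt_or_ge (√V) K₀ with hs | hs
  · have hsq := prodExp_sum_sq_le hw hmean hb
    have hlow : prodExp w (fun y => 1 + -(1 / (4 * K₀ ^ 2)) * (∑ i, X i (y i)) ^ 2) ≤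
        prodExp w (fun y => if ∑ i, X i (y i) ≤ 2 * K₀ + 2 * B then 1 else 0) := by
      refine prodExp_mono hw fun y => ?_
      split_ifs with h
      · have : 0 ≤ 1 / (4 * K₀ ^ 2) * (∑ i, X i (y i)) ^ 2 := by positivity
        linarith
      · rw [not_le] at h
        have : 1 ≤ 1 / (4 * K₀ ^ 2) * (∑ i, X i (y i)) ^ 2 := by
          rw [one_div, ← div_eq_inv_mul, one_le_div (by positivity)]
          nlinarith
        linarith
    rw [prodExp_add, prodExp_const hw, prodExp_const_mul] at hlow
    have hVK : V ≤ K₀ ^ 2 := by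
      rw [← Real.sq_sqrt hV0]
      have := Real.sqrt_nonneg V
      gcongr
    have : 1 / (4 * K₀ ^ 2) * prodExp w (fun y => (∑ i, X i (y i)) ^ 2) ≤ 1 / 4 := by
      calc 1 / (4 * K₀ ^ 2) * prodExp w (fun y => (∑ i, X i (y i)) ^ 2)
          ≤ 1 / (4 * K₀ ^ 2) * K₀ ^ 2 := by gcongr; linarith
        _ = 1 / 4 := by field_simp
    linarith
  · set s := √V with hsdef
    have hs0 : 0 < s := hK₀pos.trans_le hs
    have hss : s ^ 2 = V := Real.sq_sqrt hV0
    have hsB : s ≤ B * √n := by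
      rw [hsdef, ← Real.sqrt_sq hB.le, ← Real.sqrt_mul (sq_nonneg B)]
      exact Real.sqrt_le_sqrt (by linarith)
    obtain ⟨f, p, hp, hf, hlip, hslope⟩ := hstein (K₀ / s) (by positivity)
      ((div_le_one hs0).2 hs)
    have key := sub_le_prodExp_sum_le (X := fun i z => X i z / s) (b := B / s) hw
      (fun i => by simp only [mul_div_assoc', ← Finset.sum_div, hmean, zero_div]) (by positivity)
      (fun i z => by rw [abs_div, abs_of_pos hs0]; exact div_le_div_of_nonneg_right (hb i z) hs0.le)
      (by
        simp only [div_pow, mul_div_assoc', ← Finset.sum_div]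
        rw [← hV, hss, div_self]
        rw [← hss]; positivity) hr.le hf hlip hslope
    have h1 : B / s ≤ p - 1 / 2 - 4 * (r * (B / s)) := by
      have : c * (K₀ / s) = 4 * (r * (B / s)) + B / s := by rw [hK₀]; field_simp
      linarith
    have h2 : 1 / (4 * √n) ≤ B / s := by
      rw [div_le_div_iff₀ (by positivity) hs0]
      nlinarith
    refine le_trans (by linarith) (key.trans (prodExp_mono hw fun y => ?_))
    rw [← Finset.sum_div]
    have : (∑ i, X i (y i)) / s ≤ K₀ / s + 2 * (B / s) → ∑ i, X i (y i) ≤ 2 * K₀ + 2 * B := by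
      intro h
      rw [mul_div_assoc', ← add_div, div_le_div_iff_of_pos_right hs0] at h
      linarith
    split_ifs with h h' <;> first | exact absurd (this h) h' | simp

section Capacity

variable {X Y : Type*} [Fintype X] [Fintype Y] {W : X → Y → ℝ} {P : X → ℝ}

theorem mul_le_outDist (hW : IsChannel W) (hP : IsDist P) (x : X) (y : Y) :
    P x * W x y ≤ outDist P W y :=
  Finset.single_le_sum (f := fun x => P x * W x y)
    (fun x _ => mul_nonneg (hP.1 x) ((hW x).1 y)) (mem_univ x)

theorem isDist_outDist (hW : IsChannel W) (hP : IsDist P) : IsDist (outDist P W) := by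
  refine ⟨fun y => Finset.sum_nonneg fun x _ => mul_nonneg (hP.1 x) ((hW x).1 y), ?_⟩
  simp only [outDist]
  rw [Finset.sum_comm]
  simp only [← Finset.mul_sum, (hW _).2, mul_one, hP.2]

theorem IsDist.le_one {Z : Type*} [Fintype Z] {Q : Z → ℝ} (hQ : IsDist Q) (z : Z) : Q z ≤ 1 :=
  hQ.2 ▸ Finset.single_le_sum (fun z _ => hQ.1 z) (mem_univ z)

theorem mutInfo_le_card (hW : IsChannel W) (hP : IsDist P) :
    mutInfo P W ≤ Fintype.card X := by
  have hx : ∀ x, P x * relEnt (W x) (outDist P W) ≤ 1 := by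
    intro x
    rw [← (hW x).2, relEnt, Finset.mul_sum]
    refine Finset.sum_le_sum fun y _ => ?_
    rcases ((hW x).1 y).eq_or_lt with h | hw
    · simp [← h]
    rcases (hP.1 x).eq_or_lt with h | hp
    · simp [← h, hw.le]
    have hQ : 0 < outDist P W y := (mul_pos hp hw).trans_le (mul_le_outDist hW hP x y)
    have hlog := Real.log_le_sub_one_of_pos (div_pos hw hQ)
    calc P x * (W x y * Real.log (W x y / outDist P W y))
        ≤ P x * (W x y * (W x y / outDist P W y)) := by gcongr; linarith
      _ = W x y * (P x * W x y / outDist P W y) := by ring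
      _ ≤ W x y * 1 := by
          gcongr
          exact (div_le_one hQ).2 (mul_le_outDist hW hP x y)
      _ = W x y := mul_one _
  calc mutInfo P W ≤ ∑ _x : X, (1 : ℝ) := Finset.sum_le_sum fun x _ => hx x
    _ = Fintype.card X := by simp

theorem mutInfo_le_capacity (hW : IsChannel W) (hP : IsDist P) : mutInfo P W ≤ capacity W :=
  le_csSup ⟨Fintype.card X, by rintro _ ⟨P, hP, rfl⟩; exact mutInfo_le_card hW hP⟩ ⟨P, hP, rfl⟩

/-- The output distribution of `P` minimises `Q ↦ ∑ x, P x * relEnt (W x) Q`. -/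
theorem mutInfo_le_sum_relEnt (hW : IsChannel W) (hP : IsDist P) {Q : Y → ℝ} (hQ : IsDist Q)
    (hpos : ∀ y, 0 < outDist P W y → 0 < Q y) :
    mutInfo P W ≤ ∑ x, P x * relEnt (W x) Q := by
  rw [← sub_nonneg, mutInfo, ← Finset.sum_sub_distrib]
  have hO := isDist_outDist hW hP
  have h0 : ∑ y, (outDist P W y - Q y) = 0 := by
    rw [Finset.sum_sub_distrib, hO.2, hQ.2, sub_self]
  rw [← h0]
  have h1 : ∑ x, (P x * relEnt (W x) Q - P x * relEnt (W x) (outDist P W)) =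
      ∑ y, outDist P W y * Real.log (outDist P W y / Q y) := by
    simp only [relEnt, Finset.mul_sum, ← Finset.sum_sub_distrib]
    rw [Finset.sum_comm]
    refine Finset.sum_congr rfl fun y _ => ?_
    conv_rhs => rw [outDist, Finset.sum_mul]
    refine Finset.sum_congr rfl fun x _ => ?_
    rcases ((hW x).1 y).eq_or_lt with h | hw
    · simp [← h]
    rcases (hP.1 x).eq_or_lt with h | hp
    · simp [← h]
    have ho : 0 < outDist P W y := (mul_pos hp hw).trans_le (mul_le_outDist hW hP x y)
    have hq := hpos y ho
    change _ = P x * W x y * Real.log (outDist P W y / Q y)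
    rw [Real.log_div hw.ne' hq.ne', Real.log_div hw.ne' ho.ne', Real.log_div ho.ne' hq.ne']
    ring
  rw [h1]
  refine Finset.sum_le_sum fun y _ => ?_
  rcases (hO.1 y).eq_or_lt with h | ho
  · simp [← h, hQ.1 y]
  have hq := hpos y ho
  have hlog := Real.one_sub_inv_le_log_of_pos (div_pos ho hq)
  calc outDist P W y - Q y = outDist P W y * (1 - (outDist P W y / Q y)⁻¹) := by
        field_simp
    _ ≤ _ := by gcongr

/-- Mixing the optimal output distribution with a row of the channel keeps the divergence of that
row at most the capacity. -/
theorem relEnt_mix_le_capacity (hW : IsChannel W) (hP : isCAID W P) (x : X) {t : ℝ} (ht0 : 0 < t)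
    (ht1 : t < 1) :
    relEnt (W x) (fun y => (1 - t) * outDist P W y + t * W x y) ≤ capacity W := by
  classical
  set R : X → ℝ := fun x' => (1 - t) * P x' + t * (if x' = x then 1 else 0) with hR
  have hRd : IsDist R := by
    refine ⟨fun x' => ?_, ?_⟩
    · have := hP.1.1 x'
      have : 0 ≤ (1 - t) * P x' := mul_nonneg (by linarith) this
      simp only [hR]
      split_ifs <;> linarith
    · simp [hR, Finset.sum_add_distrib, ← Finset.mul_sum, hP.1.2]
  have hout : outDist R W = fun y => (1 - t) * outDist P W y + t * W x y := by
    funext y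
    simp [outDist, hR, add_mul, Finset.sum_add_distrib, Finset.mul_sum, mul_assoc]
  rw [← hout]
  have hI := mutInfo_le_capacity hW hRd
  have hsplit : mutInfo R W = (1 - t) * ∑ x', P x' * relEnt (W x') (outDist R W) +
      t * relEnt (W x) (outDist R W) := by
    rw [mutInfo]
    generalize outDist R W = Q
    simp [hR, add_mul, Finset.sum_add_distrib, Finset.mul_sum, mul_assoc]
  have hge := mutInfo_le_sum_relEnt hW hP.1 (isDist_outDist hW hRd) fun y hy => by
    rw [hout]
    have := mul_pos (sub_pos.2 ht1) hy
    have := mul_nonneg ht0.le ((hW x).1 y)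
    simp only; linarith
  rw [hP.2] at hge
  have := mul_le_mul_of_nonneg_left hge (sub_pos.2 ht1).le
  have : t * relEnt (W x) (outDist R W) ≤ t * capacity W := by linarith
  exact le_of_mul_le_mul_left this ht0

theorem outDist_pos_of_isCAID (hW : IsChannel W) (hP : isCAID W P) {x : X} {y : Y}
    (hy : 0 < W x y) : 0 < outDist P W y := by
  classical
  have hO := isDist_outDist hW hP.1
  refine (hO.1 y).lt_of_ne fun h0 => ?_
  have hbound : ∀ t : ℝ, 0 < t → t < 1 →
      W x y * (-Real.log t) + ∑ y' ∈ univ.erase y, W x y' * Real.log (W x y') ≤ capacity W := by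
    intro t ht0 ht1
    refine le_trans ?_ (relEnt_mix_le_capacity hW hP x ht0 ht1)
    rw [relEnt, ← Finset.add_sum_erase _ _ (mem_univ y)]
    refine add_le_add ?_ (Finset.sum_le_sum fun y' _ => ?_)
    · rw [← h0, mul_zero, zero_add, div_mul_cancel_right₀ hy.ne', Real.log_inv]
    · rcases ((hW x).1 y').eq_or_lt with h | hw
      · simp [← h]
      have h1 : 0 < (1 - t) * outDist P W y' + t * W x y' :=
        add_pos_of_nonneg_of_pos (mul_nonneg (by linarith) (hO.1 y')) (by positivity)
      have h2 : (1 - t) * outDist P W y' + t * W x y' ≤ 1 := by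
        have := hO.le_one y'
        have := (hW x).le_one y'
        nlinarith
      refine mul_le_mul_of_nonneg_left (Real.log_le_log hw ?_) hw.le
      exact (le_div_iff₀ h1).2 (mul_le_of_le_one_right hw.le h2)
  set A := ∑ y' ∈ univ.erase y, W x y' * Real.log (W x y') with hA
  set u := |capacity W - A| / W x y + 1 with hu
  have hupos : 0 < u := by positivity
  have := hbound (Real.exp (-u)) (Real.exp_pos _) (by rw [Real.exp_lt_one_iff]; linarith)
  rw [Real.log_exp, neg_neg, hu, mul_add, mul_div_cancel₀ _ hy.ne'] at this
  linarith [le_abs_self (capacity W - A)]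

theorem relEnt_outDist_le_capacity (hW : IsChannel W) (hP : isCAID W P) (x : X) :
    relEnt (W x) (outDist P W) ≤ capacity W := by
  have hlim : Filter.Tendsto
      (fun t : ℝ => relEnt (W x) (fun y => (1 - t) * outDist P W y + t * W x y))
      (nhdsWithin 0 (Set.Ioi 0)) (nhds (relEnt (W x) (outDist P W))) := by
    refine tendsto_finsetSum _ fun y _ => ?_
    rcases ((hW x).1 y).eq_or_lt with h | hw
    · simp [← h]
    have ho := outDist_pos_of_isCAID hW hP hw
    have hc : ContinuousAt (fun t : ℝ =>
        W x y * Real.log (W x y / ((1 - t) * outDist P W y + t * W x y))) 0 := by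
      refine continuousAt_const.mul (ContinuousAt.log (continuousAt_const.div ?_ ?_) ?_)
      · fun_prop
      · simpa using ho.ne'
      · simpa using ⟨hw.ne', ho.ne'⟩
    have := hc.tendsto.mono_left (nhdsWithin_le_nhds (s := Set.Ioi 0))
    simpa using this
  refine le_of_tendsto hlim ?_
  filter_upwards [Ioo_mem_nhdsGT (zero_lt_one' ℝ)] with t ht
  exact relEnt_mix_le_capacity hW hP x ht.1 ht.2

end Capacity

/-- If under every input `a` the likelihood ratio of `V a` to `Q` is at most `γ` with probability
at least `1/2 + δ`, then a code with average error at most `1/2` has at most `γ / δ` messages. -/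
theorem card_mul_le_of_avgErr_le_half {A B : Type*} [Fintype B] {V : A → B → ℝ}
    (hV : ∀ a, IsDist (V a)) {Q : B → ℝ} (hQ : IsDist Q) {γ δ : ℝ} (hγ : 0 ≤ γ)
    (h : ∀ a, 1 / 2 + δ ≤ ∑ b, V a b * (if V a b ≤ γ * Q b then 1 else 0))
    {M : ℕ} (e : Fin M → A) (d : B → Fin M) (herr : avgErr V e d ≤ 1 / 2) :
    M * δ ≤ γ := by
  rcases Nat.eq_zero_or_pos M with rfl | hM
  · simpa using hγ
  have hM' : (0 : ℝ) < M := by exact_mod_cast hM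
  have hm : ∀ m, ∑ b ∈ univ.filter (fun b => d b = m), V (e m) b ≤
      γ * (∑ b ∈ univ.filter (fun b => d b = m), Q b) + (1 / 2 - δ) := by
    intro m
    have h1 : ∑ b ∈ univ.filter (fun b => d b = m), V (e m) b ≤
        ∑ b ∈ univ.filter (fun b => d b = m), (γ * Q b +
          (V (e m) b - V (e m) b * (if V (e m) b ≤ γ * Q b then 1 else 0))) := by
      refine Finset.sum_le_sum fun b _ => ?_
      have := mul_nonneg hγ (hQ.1 b)
      split_ifs <;> linarith
    have h2 : ∑ b ∈ univ.filter (fun b => d b = m),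
          (V (e m) b - V (e m) b * (if V (e m) b ≤ γ * Q b then 1 else 0)) ≤
        ∑ b, (V (e m) b - V (e m) b * (if V (e m) b ≤ γ * Q b then 1 else 0)) := by
      refine Finset.sum_le_sum_of_subset_of_nonneg (Finset.filter_subset _ _) fun b _ _ => ?_
      have := (hV (e m)).1 b
      split_ifs <;> linarith
    rw [Finset.sum_sub_distrib (s := univ), (hV (e m)).2] at h2
    rw [Finset.sum_add_distrib, ← Finset.mul_sum] at h1
    linarith [h (e m)]
  have hsum := Finset.sum_le_sum fun m (_ : m ∈ univ) => hm m
  rw [Finset.sum_add_distrib, ← Finset.mul_sum, Finset.sum_fiberwise, hQ.2] at hsum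
  simp only [Finset.sum_const, Finset.card_univ, Fintype.card_fin, nsmul_eq_mul] at hsum
  rw [avgErr, one_div (M : ℝ)] at herr
  have hhalf : (M : ℝ) * (1 / 2) ≤
      ∑ m, ∑ b ∈ univ.filter (fun b => d b = m), V (e m) b := by
    rw [← le_inv_mul_iff₀ hM']
    linarith
  linarith

/-- The likelihood ratio of a product distribution is the exponential of the sum of the
log-likelihood ratios. -/
theorem prod_le_exp_mul_prod {ι : Type*} [Fintype ι] {p q : ι → ℝ} {τ : ℝ} (hp : ∀ i, 0 < p i)
    (hq : ∀ i, 0 < q i) (h : ∑ i, Real.log (p i / q i) ≤ τ) :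
    ∏ i, p i ≤ Real.exp τ * ∏ i, q i := by
  rw [← div_le_iff₀ (Finset.prod_pos fun i _ => hq i), ← Finset.prod_div_distrib]
  calc ∏ i, p i / q i = Real.exp (∑ i, Real.log (p i / q i)) := by
        rw [Real.exp_sum]
        exact Finset.prod_congr rfl fun i _ => (Real.exp_log (div_pos (hp i) (hq i))).symm
    _ ≤ Real.exp τ := Real.exp_le_exp.2 h

/-- For a DMC `W` with `V_min = 0` and `V_max > 0`, at `ε = 1/2`,
`log M*(Wⁿ, 1/2) ≤ n C + (1/2) log n + K` for some constant `K`. -/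
theorem converse_eps_half_Vmin_zero_Vmax_pos
    {X Y : Type*} [Fintype X] [Fintype Y] [Nonempty X] [Nonempty Y]
    (W : X → Y → ℝ) (hW : IsChannel W) (hVmin : Vmin W = 0) (hVmax : 0 < Vmax W) :
    ∃ K : ℝ, ∀ n : ℕ, 1 ≤ n →
      Real.log (Mstar (fun (xs : Fin n → X) (ys : Fin n → Y) => ∏ i, W (xs i) (ys i)) (1/2)) ≤
        (n : ℝ) * capacity W + (1 / 2) * Real.log n + K := by
  obtain ⟨P, hP⟩ : ∃ P, isCAID W P := by
    by_contra! hne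
    simp [Vmax, hne] at hVmax
  set Q := outDist P W with hQdef
  have hQ : IsDist Q := isDist_outDist hW hP.1
  set Z : X → Y → ℝ := fun x y => Real.log (W x y / Q y) - relEnt (W x) Q with hZ
  obtain ⟨B, hB⟩ := (Set.finite_range fun a : X × Y => |Z a.1 a.2|).bddAbove
  have hZB : ∀ x y, |Z x y| ≤ max B 1 := fun x y => (hB ⟨(x, y), rfl⟩).trans (le_max_left _ _)
  have hZmean : ∀ x, ∑ y, W x y * Z x y = 0 := fun x => by
    simp only [hZ, mul_sub, Finset.sum_sub_distrib, ← Finset.sum_mul, (hW x).2, one_mul]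
    rw [relEnt, sub_self]
  obtain ⟨K, hK⟩ := exists_half_add_le_prodExp_sum_le Y (B := max B 1) (by positivity)
  refine ⟨K + Real.log 4, fun n hn => ?_⟩
  have hn0 : (0 : ℝ) < n := by exact_mod_cast hn
  set V : (Fin n → X) → (Fin n → Y) → ℝ := fun xs ys => ∏ i, W (xs i) (ys i) with hVdef
  have hV : ∀ xs, IsDist (V xs) := fun xs =>
    ⟨fun ys => Finset.prod_nonneg fun i _ => (hW _).1 _, sum_prod_eq_one fun i => hW (xs i)⟩
  have hQn : IsDist fun ys : Fin n → Y => ∏ i, Q (ys i) :=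
    ⟨fun ys => Finset.prod_nonneg fun i _ => hQ.1 _, sum_prod_eq_one fun _ => hQ⟩
  set τ := n * capacity W + K with hτ
  have hratio : ∀ xs, 1 / 2 + 1 / (4 * √n) ≤
      ∑ ys, V xs ys * (if V xs ys ≤ Real.exp τ * ∏ i, Q (ys i) then 1 else 0) := by
    intro xs
    refine (hK n hn (fun i => W (xs i)) (fun i => Z (xs i)) (fun i => hW _) (fun i => hZmean _)
      fun i => hZB _).trans (Finset.sum_le_sum fun ys _ => ?_)
    change V xs ys * _ ≤ _
    rcases ((hV xs).1 ys).eq_or_lt with h | hpos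
    · simp [← h]
    refine mul_le_mul_of_nonneg_left ?_ hpos.le
    have hWpos : ∀ i, 0 < W (xs i) (ys i) := fun i =>
      ((hW _).1 _).lt_of_ne' (Finset.prod_ne_zero_iff.1 hpos.ne' i (mem_univ i))
    have himp : ∑ i, Z (xs i) (ys i) ≤ K → V xs ys ≤ Real.exp τ * ∏ i, Q (ys i) := by
      intro hle
      refine prod_le_exp_mul_prod hWpos (fun i => outDist_pos_of_isCAID hW hP (hWpos i)) ?_
      have hD : ∑ i, relEnt (W (xs i)) Q ≤ n * capacity W := by
        calc ∑ i, relEnt (W (xs i)) Q ≤ ∑ _i : Fin n, capacity W :=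
              Finset.sum_le_sum fun i _ => relEnt_outDist_le_capacity hW hP _
          _ = n * capacity W := by simp
      simp only [hZ, Finset.sum_sub_distrib] at hle
      linarith
    by_cases h : ∑ i, Z (xs i) (ys i) ≤ K
    · simp [h, himp h]
    · simp only [h, if_false]
      split_ifs <;> simp
  have hcode : ∀ M : ℕ, (∃ e : Fin M → Fin n → X, ∃ d : (Fin n → Y) → Fin M,
      avgErr V e d ≤ 1 / 2) → (M : ℝ) ≤ Real.exp τ * (4 * √n) := by
    rintro M ⟨e, d, h⟩
    have := card_mul_le_of_avgErr_le_half hV hQn (Real.exp_pos τ).le hratio e d h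
    rwa [mul_one_div, div_le_iff₀ (by positivity)] at this
  have hone : ∃ e : Fin 1 → Fin n → X, ∃ d : (Fin n → Y) → Fin 1, avgErr V e d ≤ 1 / 2 := by
    refine ⟨fun _ _ => Classical.arbitrary X, fun _ => 0, ?_⟩
    simp [avgErr, (hV _).2]
  have hbdd : BddAbove {M : ℕ | ∃ e : Fin M → Fin n → X, ∃ d : (Fin n → Y) → Fin M,
      avgErr V e d ≤ 1 / 2} :=
    ⟨⌊Real.exp τ * (4 * √n)⌋₊, fun M hM => Nat.le_floor (hcode M hM)⟩
  have hle := hcode _ (Nat.sSup_mem ⟨1, hone⟩ hbdd)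
  have hpos : 1 ≤ Mstar V (1 / 2) := le_csSup hbdd hone
  calc Real.log (Mstar V (1 / 2)) ≤ Real.log (Real.exp τ * (4 * √n)) :=
        Real.log_le_log (by exact_mod_cast hpos) hle
    _ = n * capacity W + 1 / 2 * Real.log n + (K + Real.log 4) := by
        rw [Real.log_mul (by positivity) (by positivity), Real.log_exp,
          Real.log_mul (by norm_num) (by positivity), Real.log_sqrt hn0.le, hτ]
        ring
end

section
/- Let ε ∈ (0,1) and let W be any channel from a finite set X to a finite set Y. Then for any δ ∈ (0, 1−ε), log M*(W, ε) ≤ inf_{Q ∈ P(Y)} sup_{x ∈ X} D_s^{ε+δ}(W(·|x) ‖ Q) + log(1/δ), where the infimum is over all probability distributions Q on Y. -/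
open Finset MeasureTheory

/-- Relative entropy information spectrum divergence `D_s^ε(P‖Q)`, as an extended real:
the supremum of all `R` with `P[log(P/Q) ≤ R] ≤ ε`, where `log(P(z)/Q(z)) = -∞` when
`P z = 0` and `+∞` when `P z > 0 = Q z`. -/
noncomputable def Ds {Z : Type*} [Fintype Z] (ε : ℝ) (P Q : Z → ℝ) : EReal :=
  sSup ((fun R : ℝ => (R : EReal)) ''
    {R : ℝ | ∑ z, (if P z = 0 ∨ (0 < Q z ∧ Real.log (P z / Q z) ≤ R) then P z else 0) ≤ ε})

/-- The information spectrum event `log (P/Q) ≤ R` has probability exceeding `ε` as soon as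
`R` lies strictly above the information spectrum divergence. -/
lemma lt_sum_of_Ds_lt {Z : Type*} [Fintype Z] {ε R : ℝ} {P Q : Z → ℝ} (h : Ds ε P Q < R) :
    ε < ∑ z, (if P z = 0 ∨ (0 < Q z ∧ Real.log (P z / Q z) ≤ R) then P z else 0) := by
  by_contra! hle
  exact h.not_ge (le_sSup ⟨R, hle, rfl⟩)

lemma le_exp_mul_add_sub_ite {p q R : ℝ} (hp : 0 ≤ p) (hq : 0 ≤ q) :
    p ≤ Real.exp R * q + (p - if p = 0 ∨ (0 < q ∧ Real.log (p / q) ≤ R) then p else 0) := by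
  have hR := Real.exp_pos R
  split_ifs with h
  · rcases h with rfl | ⟨hq0, hlog⟩
    · simpa using mul_nonneg hR.le hq
    · rcases hp.eq_or_lt with rfl | hp0
      · simpa using mul_nonneg hR.le hq
      · have := (Real.log_le_iff_le_exp (div_pos hp0 hq0)).1 hlog
        rw [div_le_iff₀ hq0] at this
        linarith
  · linarith [mul_nonneg hR.le hq]

/-- Change of measure: the `P`-probability of a set is at most `exp R` times its
`Q`-probability plus the `P`-probability that `log (P/Q) > R`. -/
lemma sum_le_exp_mul_sum_add {Z : Type*} [Fintype Z] {P Q : Z → ℝ} (hP : IsDist P)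
    (hQ : IsDist Q) (R : ℝ) (D : Finset Z) :
    ∑ z ∈ D, P z ≤ Real.exp R * ∑ z ∈ D, Q z +
      (1 - ∑ z, (if P z = 0 ∨ (0 < Q z ∧ Real.log (P z / Q z) ≤ R) then P z else 0)) := by
  rw [← hP.2, ← Finset.sum_sub_distrib, Finset.mul_sum]
  calc ∑ z ∈ D, P z
      ≤ ∑ z ∈ D, (Real.exp R * Q z +
          (P z - if P z = 0 ∨ (0 < Q z ∧ Real.log (P z / Q z) ≤ R) then P z else 0)) :=
        Finset.sum_le_sum fun z _ => le_exp_mul_add_sub_ite (hP.1 z) (hQ.1 z)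
    _ ≤ _ := by
        rw [Finset.sum_add_distrib]
        refine add_le_add le_rfl
          (Finset.sum_le_sum_of_subset_of_nonneg (Finset.subset_univ D) fun z _ _ => ?_)
        split_ifs
        · simp
        · simpa using hP.1 z

lemma le_sum_of_avgErr_le {A B : Type*} [Fintype B] {M : ℕ} {V : A → B → ℝ} {ε : ℝ}
    {e : Fin M → A} {d : B → Fin M} (hM : 0 < M) (h : avgErr V e d ≤ ε) :
    (1 - ε) * M ≤ ∑ m : Fin M, ∑ b ∈ Finset.univ.filter (fun b => d b = m), V (e m) b := by
  have hM' : (0 : ℝ) < M := Nat.cast_pos.2 hM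
  rw [← le_div_iff₀ hM', div_eq_inv_mul, ← one_div]
  unfold avgErr at h
  linarith

/-- The supremum defining `Mstar` is attained by a code with at least one message. -/
lemma exists_code_Mstar {X Y : Type*} [Fintype X] [Fintype Y] [Nonempty X] [Nonempty Y]
    {W : X → Y → ℝ} (hW : IsChannel W) {ε : ℝ} (hε : ε ∈ Set.Ioo (0 : ℝ) 1) :
    0 < Mstar W ε ∧
      ∃ e : Fin (Mstar W ε) → X, ∃ d : Y → Fin (Mstar W ε), avgErr W e d ≤ ε := by
  have hone : 1 ∈ {M : ℕ | ∃ e : Fin M → X, ∃ d : Y → Fin M, avgErr W e d ≤ ε} := by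
    refine ⟨fun _ => Classical.arbitrary X, fun _ => 0, ?_⟩
    have hsum := (hW (Classical.arbitrary X)).2
    simp [avgErr, hsum, hε.1.le]
  have hbdd : BddAbove {M : ℕ | ∃ e : Fin M → X, ∃ d : Y → Fin M, avgErr W e d ≤ ε} := by
    refine ⟨⌈(Fintype.card Y : ℝ) / (1 - ε)⌉₊, ?_⟩
    rintro M ⟨e, d, h⟩
    have hM : 0 < M := (d (Classical.arbitrary Y)).pos
    have hle := le_sum_of_avgErr_le hM h
    have hcard : ∑ m : Fin M, ∑ b ∈ Finset.univ.filter (fun b => d b = m), W (e m) b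
        ≤ Fintype.card Y := by
      calc _ ≤ ∑ m : Fin M, ∑ b ∈ Finset.univ.filter (fun b => d b = m), (1 : ℝ) := by
            refine Finset.sum_le_sum fun m _ => Finset.sum_le_sum fun b _ => ?_
            rw [← (hW (e m)).2]
            exact Finset.single_le_sum (fun y _ => (hW (e m)).1 y) (Finset.mem_univ b)
        _ = Fintype.card Y := by
            rw [Finset.sum_fiberwise]
            simp
    have hdiv : (M : ℝ) ≤ Fintype.card Y / (1 - ε) := by
      rw [le_div_iff₀ (by linarith [hε.2])]
      linarith
    exact_mod_cast hdiv.trans (Nat.le_ceil _)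
  exact ⟨le_csSup hbdd hone, Nat.sSup_mem ⟨1, hone⟩ hbdd⟩

/-- One-shot converse: for any channel `W : X → Y`, `ε ∈ (0,1)` and
`δ ∈ (0, 1-ε)`,
`log M*(W,ε) ≤ inf_{Q ∈ P(Y)} sup_{x ∈ X} D_s^{ε+δ}(W(·|x)‖Q) + log(1/δ)`. -/
theorem one_shot_converse
    {X Y : Type*} [Fintype X] [Fintype Y] [Nonempty X] [Nonempty Y]
    (W : X → Y → ℝ) (hW : IsChannel W) (ε δ : ℝ)
    (hε : ε ∈ Set.Ioo (0 : ℝ) 1) (hδ : δ ∈ Set.Ioo 0 (1 - ε)) :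
    (Real.log (Mstar W ε) : EReal) ≤
      (⨅ Q : {Q : Y → ℝ // IsDist Q}, ⨆ x : X, Ds (ε + δ) (W x) Q.1)
        + ((Real.log (1 / δ) : ℝ) : EReal) := by
  obtain ⟨hM, e, d, hcode⟩ := exists_code_Mstar hW hε
  have hle := le_sum_of_avgErr_le hM hcode
  generalize Mstar W ε = M at *
  have hM' : (0 : ℝ) < M := Nat.cast_pos.2 hM
  have hδ0 : 0 < δ := hδ.1
  have hlog : Real.log M = Real.log (M * δ) + Real.log (1 / δ) := by
    rw [← Real.log_mul (by positivity) (by positivity)]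
    congr 1
    field_simp
  rw [hlog, EReal.coe_add]
  gcongr
  refine le_iInf fun ⟨Q, hQ⟩ => ?_
  by_contra! hlt
  have hspec := fun x => lt_sum_of_Ds_lt ((le_iSup (fun x => Ds (ε + δ) (W x) Q) x).trans_lt hlt)
  have : Nonempty (Fin M) := ⟨⟨0, hM⟩⟩
  have hsucc : ∑ m : Fin M, ∑ b ∈ Finset.univ.filter (fun b => d b = m), W (e m) b <
      ∑ m : Fin M, (M * δ * ∑ b ∈ Finset.univ.filter (fun b => d b = m), Q b +
        (1 - (ε + δ))) := by
    refine Finset.sum_lt_sum_of_nonempty Finset.univ_nonempty fun m _ => ?_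
    have hm := sum_le_exp_mul_sum_add (hW (e m)) hQ (Real.log (M * δ))
      (Finset.univ.filter fun b => d b = m)
    rw [Real.exp_log (by positivity)] at hm
    linarith [hspec (e m)]
  rw [Finset.sum_add_distrib, ← Finset.mul_sum, Finset.sum_fiberwise, hQ.2] at hsucc
  simp only [Finset.sum_const, Finset.card_univ, Fintype.card_fin, nsmul_eq_mul] at hsucc
  linarith
end

section
/- Let P, Q be probability distributions on a finite set Z, let ε ∈ (0,1) and δ ∈ (0, 1−ε). Then D_h^ε(P‖Q) ≤ D_s^{ε+δ}(P‖Q) + log((1−ε)/δ). -/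
open Finset MeasureTheory

/-- `ε`-hypothesis testing divergence `D_h^ε(P‖Q)`, as an extended real. -/
noncomputable def Dh {Z : Type*} [Fintype Z] (ε : ℝ) (P Q : Z → ℝ) : EReal :=
  sSup ((fun R : ℝ => (R : EReal)) ''
    {R : ℝ | ∃ ξ : Z → ℝ, (∀ z, 0 ≤ ξ z ∧ ξ z ≤ 1) ∧
      (∑ z, Q z * ξ z ≤ (1 - ε) * Real.exp (-R)) ∧ (1 - ε ≤ ∑ z, P z * ξ z)})

/-- On the event `log (p / q) ≤ R`, the mass `p` is bounded by splitting it along a test `ξ`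
and using `p ≤ exp R * q` on the accepted part. -/
lemma ite_le_exp_mul_add {p q ξ R : ℝ} (hp : 0 ≤ p) (hq : 0 ≤ q) (hξ₀ : 0 ≤ ξ) (hξ₁ : ξ ≤ 1) :
    (if p = 0 ∨ (0 < q ∧ Real.log (p / q) ≤ R) then p else 0)
      ≤ Real.exp R * (q * ξ) + (p - p * ξ) := by
  have hrest : 0 ≤ p - p * ξ := by nlinarith
  have hacc : 0 ≤ Real.exp R * (q * ξ) := by positivity
  split_ifs with h
  · rcases h with h | ⟨hq', hlog⟩
    · subst h; linarith
    · rcases hp.eq_or_lt with rfl | hp'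
      · linarith
      · have hpq : p ≤ Real.exp R * q :=
          (div_le_iff₀ hq').1 ((Real.log_le_iff_le_exp (div_pos hp' hq')).1 hlog)
        nlinarith [mul_le_mul_of_nonneg_right hpq hξ₀]
  · linarith

/-- The information spectrum at level `R` is controlled by the two errors of any test `ξ`. -/
lemma spectrum_le_exp_mul_add {Z : Type*} [Fintype Z] {P Q ξ : Z → ℝ} (hP : IsDist P)
    (hQ : ∀ z, 0 ≤ Q z) (hξ : ∀ z, 0 ≤ ξ z ∧ ξ z ≤ 1) (R : ℝ) :
    ∑ z, (if P z = 0 ∨ (0 < Q z ∧ Real.log (P z / Q z) ≤ R) then P z else 0)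
      ≤ Real.exp R * ∑ z, Q z * ξ z + (1 - ∑ z, P z * ξ z) := by
  rw [← hP.2, Finset.mul_sum, ← Finset.sum_sub_distrib, ← Finset.sum_add_distrib]
  exact Finset.sum_le_sum fun z _ =>
    ite_le_exp_mul_add (hP.1 z) (hQ z) (hξ z).1 (hξ z).2

/-- For distributions `P, Q` on a finite set, `ε ∈ (0,1)` and
`δ ∈ (0, 1-ε)`, `D_h^ε(P‖Q) ≤ D_s^{ε+δ}(P‖Q) + log((1-ε)/δ)`. -/
theorem Dh_le_Ds
    {Z : Type*} [Fintype Z] (P Q : Z → ℝ) (hP : IsDist P) (hQ : IsDist Q)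
    (ε δ : ℝ) (hε : ε ∈ Set.Ioo (0 : ℝ) 1) (hδ : δ ∈ Set.Ioo 0 (1 - ε)) :
    Dh ε P Q ≤ Ds (ε + δ) P Q + ((Real.log ((1 - ε) / δ) : ℝ) : EReal) := by
  obtain ⟨hδ₀, hδ₁⟩ := hδ
  have hε' : 0 < 1 - ε := hδ₀.trans hδ₁
  refine sSup_le ?_
  rintro _ ⟨R, ⟨ξ, hξ, hQξ, hPξ⟩, rfl⟩
  set c := Real.log ((1 - ε) / δ) with hc
  have hexp : Real.exp (R - c) * ((1 - ε) * Real.exp (-R)) = δ := by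
    rw [Real.exp_sub, hc, Real.exp_log (div_pos hε' hδ₀), Real.exp_neg]
    field_simp
  have hmem : ((R - c : ℝ) : EReal) ≤ Ds (ε + δ) P Q := by
    refine le_sSup ⟨R - c, ?_, rfl⟩
    have hspec := spectrum_le_exp_mul_add hP hQ.1 hξ (R - c)
    have hmul := mul_le_mul_of_nonneg_left hQξ (Real.exp_pos (R - c)).le
    rw [Set.mem_ofPred_eq]
    linarith
  calc (R : EReal) = ((R - c : ℝ) : EReal) + (c : EReal) := by
        rw [← EReal.coe_add, sub_add_cancel]
    _ ≤ Ds (ε + δ) P Q + (c : EReal) := by gcongr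
end

section
/- Let P be a probability distribution on a finite set Z, let I be a countable index set, let q be a probability distribution on I, let Q^i be probability distributions on Z for each i ∈ I, and let Q := Σ_{i∈I} q(i)·Q^i. Then for every ε ∈ (0,1), D_s^ε(P‖Q) ≤ inf_{i ∈ I} ( D_s^ε(P‖Q^i) − log q(i) ). -/
open Finset MeasureTheory

/-- `log` with values in the extended reals, with `log t = -∞` for `t ≤ 0`
(the natural convention for probabilities). -/
noncomputable def elog (t : ℝ) : EReal :=
  if 0 < t then ((Real.log t : ℝ) : EReal) else ⊥

/-- The information spectrum divergence is never `-∞`. -/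
lemma Ds_ne_bot {Z : Type*} [Fintype Z] {ε : ℝ} (hε : 0 ≤ ε) (P Q : Z → ℝ) :
    Ds ε P Q ≠ ⊥ := by
  obtain ⟨B, hB⟩ := (Set.finite_range fun z => Real.log (P z / Q z)).bddBelow
  have hmem : ((B - 1 : ℝ) : EReal) ≤ Ds ε P Q := by
    refine le_sSup ⟨B - 1, ?_, rfl⟩
    refine (Finset.sum_nonpos fun z _ => ?_).trans hε
    have hz : B ≤ Real.log (P z / Q z) := hB ⟨z, rfl⟩
    split_ifs with h
    · rcases h with h | h
      · exact h.le
      · linarith [h.2]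
    · exact le_rfl
  exact ne_bot_of_le_ne_bot (EReal.coe_ne_bot _) hmem

/-- If `c • Q' ≤ Q` pointwise with `0 < c`, then `D_s^ε(P‖Q) ≤ D_s^ε(P‖Q') - log c`. -/
lemma Ds_le_sub_log {Z : Type*} [Fintype Z] {ε c : ℝ} {P Q Q' : Z → ℝ} (hP : ∀ z, 0 ≤ P z)
    (hc : 0 < c) (hQ : ∀ z, c * Q' z ≤ Q z) :
    Ds ε P Q ≤ Ds ε P Q' - (Real.log c : ℝ) := by
  refine sSup_le ?_
  rintro _ ⟨R, hR, rfl⟩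
  rw [EReal.le_sub_iff_add_le (Or.inl (EReal.coe_ne_bot _)) (Or.inl (EReal.coe_ne_top _)),
    ← EReal.coe_add]
  refine le_sSup ⟨R + Real.log c, ?_, rfl⟩
  rw [Set.mem_ofPred_eq] at hR ⊢
  refine (Finset.sum_le_sum fun z _ => ?_).trans hR
  by_cases hz : P z = 0
  · simp [hz]
  by_cases h : 0 < Q' z ∧ Real.log (P z / Q' z) ≤ R + Real.log c
  · obtain ⟨hQ', hlog⟩ := h
    have hQz : 0 < Q z := (mul_pos hc hQ').trans_le (hQ z)
    have hmono := Real.log_le_log (mul_pos hc hQ') (hQ z)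
    rw [Real.log_mul hc.ne' hQ'.ne'] at hmono
    rw [Real.log_div hz hQ'.ne'] at hlog
    have hle : Real.log (P z / Q z) ≤ R := by
      rw [Real.log_div hz hQz.ne']
      linarith
    rw [if_pos (c := P z = 0 ∨ 0 < Q z ∧ _) (Or.inr ⟨hQz, hle⟩)]
    split_ifs
    exacts [le_rfl, hP z]
  · rw [if_neg (by tauto)]
    split_ifs <;> simp [hP z]

lemma IsDist.apply_le_one {Z : Type*} [Fintype Z] {P : Z → ℝ} (hP : IsDist P) (z : Z) :
    P z ≤ 1 :=
  hP.2 ▸ Finset.single_le_sum (fun w _ => hP.1 w) (Finset.mem_univ z)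

/-- If `Q = Σ_i q(i) Qⁱ` is a countable convex combination of
distributions, then `D_s^ε(P‖Q) ≤ inf_i (D_s^ε(P‖Qⁱ) - log q(i))`. -/
theorem Ds_convex_combination
    {Z : Type*} [Fintype Z] {I : Type*} [Countable I]
    (P : Z → ℝ) (hP : IsDist P)
    (q : I → ℝ) (hq : ∀ i, 0 ≤ q i) (hq1 : ∑' i, q i = 1)
    (Qi : I → Z → ℝ) (hQi : ∀ i, IsDist (Qi i))
    (Q : Z → ℝ) (hQ : ∀ z, Q z = ∑' i, q i * Qi i z)
    (ε : ℝ) (hε : ε ∈ Set.Ioo (0 : ℝ) 1) :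
    Ds ε P Q ≤ ⨅ i : I, (Ds ε P (Qi i) - elog (q i)) := by
  refine le_iInf fun i => ?_
  rcases (hq i).eq_or_lt with h0 | hpos
  · rw [← h0, elog, if_neg (lt_irrefl _), sub_eq_add_neg, EReal.neg_bot,
      EReal.add_top_of_ne_bot (Ds_ne_bot hε.1.le _ _)]
    exact le_top
  · rw [elog, if_pos hpos]
    refine Ds_le_sub_log hP.1 hpos fun z => ?_
    have hnonneg : ∀ j, 0 ≤ q j * Qi j z := fun j => mul_nonneg (hq j) ((hQi j).1 z)
    have hq_summable : Summable q := by
      by_contra h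
      simp [tsum_eq_zero_of_not_summable h] at hq1
    have hsummable : Summable fun j => q j * Qi j z :=
      hq_summable.of_nonneg_of_le hnonneg fun j =>
        mul_le_of_le_one_right (hq j) ((hQi j).apply_le_one z)
    rw [hQ z]
    exact hsummable.le_tsum i fun j _ => hnonneg j
end

section
/- Let P be a probability distribution on a finite set X and let V, W be channels from X to a finite set Y. Then for every ε ∈ (0,1), D_s^ε(P × W ‖ P × V) ≤ sup_{x : P(x) > 0} D_s^ε(W(·|x) ‖ V(·|x)), where P × W denotes the joint distribution (x,y) ↦ P(x)·W(y|x) on X × Y. -/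
open Finset MeasureTheory

/-- The cumulative information spectrum of `P × W` relative to `P × V` is the `P`-average of the
cumulative information spectra of the conditional distributions. -/
lemma sum_joint_spectrum_eq {X Y : Type*} [Fintype X] [Fintype Y]
    (P : X → ℝ) (hP : ∀ x, 0 ≤ P x) (W V : X → Y → ℝ) (R : ℝ) :
    ∑ p : X × Y, (if P p.1 * W p.1 p.2 = 0 ∨ (0 < P p.1 * V p.1 p.2 ∧
        Real.log (P p.1 * W p.1 p.2 / (P p.1 * V p.1 p.2)) ≤ R)
      then P p.1 * W p.1 p.2 else 0) =
    ∑ x, P x * ∑ y, (if W x y = 0 ∨ (0 < V x y ∧ Real.log (W x y / V x y) ≤ R)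
      then W x y else 0) := by
  rw [Fintype.sum_prod_type]
  refine Finset.sum_congr rfl fun x _ => ?_
  rw [Finset.mul_sum]
  refine Finset.sum_congr rfl fun y _ => ?_
  rcases (hP x).eq_or_lt with hx | hx
  · simp [← hx]
  · simp only [mul_div_mul_left _ _ hx.ne', mul_pos_iff_of_pos_left hx, mul_eq_zero, hx.ne',
      false_or, mul_ite, mul_zero]

/-- If a weighted average with respect to a distribution is at most `ε`, then some value in the
support is at most `ε`. -/
lemma IsDist.exists_le_of_sum_le {X : Type*} [Fintype X] {P : X → ℝ} (hP : IsDist P)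
    {f : X → ℝ} {ε : ℝ} (h : ∑ x, P x * f x ≤ ε) : ∃ x, 0 < P x ∧ f x ≤ ε := by
  by_contra! hf
  have hε : ∑ x, P x * ε = ε := by rw [← Finset.sum_mul, hP.2, one_mul]
  obtain ⟨x, -, hx⟩ : ∃ x ∈ Finset.univ, 0 < P x :=
    Finset.exists_lt_of_sum_lt (by simp [hP.2])
  have : ∑ x, P x * ε < ∑ x, P x * f x := by
    refine Finset.sum_lt_sum (fun z _ => ?_)
      ⟨x, Finset.mem_univ x, mul_lt_mul_of_pos_left (hf x hx) hx⟩
    rcases (hP.1 z).eq_or_lt with hz | hz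
    · simp [← hz]
    · exact (mul_lt_mul_of_pos_left (hf z hz) hz).le
  linarith

/-- For a distribution `P` on `X` and channels `V, W : X → Y`,
`D_s^ε(P × W ‖ P × V) ≤ sup_{x : P(x) > 0} D_s^ε(W(·|x) ‖ V(·|x))`. -/
theorem Ds_joint_le_sup_symbols
    {X Y : Type*} [Fintype X] [Fintype Y]
    (P : X → ℝ) (hP : IsDist P) (W V : X → Y → ℝ)
    (hW : IsChannel W) (hV : IsChannel V)
    (ε : ℝ) (hε : ε ∈ Set.Ioo (0 : ℝ) 1) :
    Ds ε (fun p : X × Y => P p.1 * W p.1 p.2) (fun p : X × Y => P p.1 * V p.1 p.2) ≤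
      ⨆ x : {x : X // 0 < P x}, Ds ε (W x.1) (V x.1) := by
  refine sSup_le ?_
  rintro _ ⟨R, hR, rfl⟩
  rw [Set.mem_ofPred_eq, sum_joint_spectrum_eq P hP.1 W V R] at hR
  obtain ⟨x, hx, hxR⟩ := hP.exists_le_of_sum_le hR
  exact le_iSup_of_le ⟨x, hx⟩ (le_sSup ⟨R, hxR, rfl⟩)
end

section
/- Let I be a finite set, let Q and P_i (for i ∈ I) be probability distributions on a finite set Z such that Q(z) > 0 whenever P_i(z) > 0 for some i. Let (i_1, …, i_n) ∈ I^n, and define D_n := (1/n)·Σ_{k=1}^n D(P_{i_k}‖Q) and V_n := (1/n)·Σ_{k=1}^n V(P_{i_k}‖Q). Then for every ε ∈ (0,1), D_s^ε(P_{i_1} × ⋯ × P_{i_n} ‖ Q^{×n}) ≤ n·D_n + √(n·V_n/(1−ε)), where P_{i_1} × ⋯ × P_{i_n} is the product distribution on Z^n and Q^{×n} is the n-fold product of Q. -/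
open Finset MeasureTheory

/-- Summing a product weight times a function of one coordinate gives the one-coordinate sum. -/
lemma sum_prod_mul_apply {ι Z : Type*} [Fintype ι] [DecidableEq ι] [Fintype Z]
    (P : ι → Z → ℝ) (hP : ∀ k, ∑ z, P k z = 1) (i : ι) (g : Z → ℝ) :
    ∑ zs : ι → Z, (∏ k, P k (zs k)) * g (zs i) = ∑ z, P i z * g z := by
  have hfactor : ∀ zs : ι → Z, (∏ k, P k (zs k)) * g (zs i) =
      ∏ k, P k (zs k) * (if k = i then g (zs k) else 1) := by
    intro zs
    rw [prod_mul_distrib, prod_ite_eq' univ i (fun k => g (zs k)), if_pos (mem_univ i)]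
  have hswap := prod_univ_sum (fun _ : ι => (univ : Finset Z))
    (fun k z => P k z * (if k = i then g z else 1))
  rw [Fintype.piFinset_univ] at hswap
  rw [sum_congr rfl fun zs _ => hfactor zs, ← hswap, prod_eq_single i]
  · simp
  · intro k _ hk
    simp [hk, hP]
  · simp

/-- Centred functions of distinct coordinates are uncorrelated under a product weight. -/
lemma sum_prod_mul_apply_mul_apply_eq_zero {ι Z : Type*} [Fintype ι] [DecidableEq ι] [Fintype Z]
    (P f : ι → Z → ℝ) {i j : ι} (hf : ∑ z, P i z * f i z = 0) (hij : i ≠ j) :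
    ∑ zs : ι → Z, (∏ k, P k (zs k)) * (f i (zs i) * f j (zs j)) = 0 := by
  have hfactor : ∀ zs : ι → Z, (∏ k, P k (zs k)) * (f i (zs i) * f j (zs j)) =
      ∏ k, P k (zs k) * ((if k = i then f k (zs k) else 1) *
        (if k = j then f k (zs k) else 1)) := by
    intro zs
    rw [prod_mul_distrib, prod_mul_distrib, prod_ite_eq' univ i (fun k => f k (zs k)),
      prod_ite_eq' univ j (fun k => f k (zs k)), if_pos (mem_univ i), if_pos (mem_univ j)]
  have hswap := prod_univ_sum (fun _ : ι => (univ : Finset Z))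
    (fun k z => P k z * ((if k = i then f k z else 1) * (if k = j then f k z else 1)))
  rw [Fintype.piFinset_univ] at hswap
  rw [sum_congr rfl fun zs _ => hfactor zs, ← hswap]
  exact prod_eq_zero (mem_univ i) (by simpa [hij] using hf)

/-- Under a product distribution, the variance of a sum of centred functions of the coordinates
is the sum of the variances. -/
lemma sum_prod_mul_sum_sq {ι Z : Type*} [Fintype ι] [DecidableEq ι] [Fintype Z]
    (P f : ι → Z → ℝ) (hP : ∀ k, ∑ z, P k z = 1) (hf : ∀ k, ∑ z, P k z * f k z = 0) :
    ∑ zs : ι → Z, (∏ k, P k (zs k)) * (∑ k, f k (zs k)) ^ 2 = ∑ k, ∑ z, P k z * f k z ^ 2 := by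
  simp_rw [sq, sum_mul_sum, mul_sum]
  rw [sum_comm]
  refine sum_congr rfl fun i _ => ?_
  rw [sum_comm, sum_eq_single i]
  · exact sum_prod_mul_apply P hP i (fun z => f i z * f i z)
  · exact fun j _ hj => sum_prod_mul_apply_mul_apply_eq_zero P f (hf i) hj.symm
  · simp

lemma IsDist.prod {ι Z : Type*} [Fintype ι] [DecidableEq ι] [Fintype Z] {P : ι → Z → ℝ}
    (hP : ∀ k, IsDist (P k)) : IsDist (fun zs : ι → Z => ∏ k, P k (zs k)) := by
  refine ⟨fun zs => prod_nonneg fun k _ => (hP k).1 _, ?_⟩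
  have hswap := prod_univ_sum (fun _ : ι => (univ : Finset Z)) P
  rw [Fintype.piFinset_univ] at hswap
  rw [← hswap]
  exact prod_eq_one fun k _ => (hP k).2

lemma IsDist.sum_mul_log_sub_relEnt {Z : Type*} [Fintype Z] {P : Z → ℝ} (hP : IsDist P)
    (Q : Z → ℝ) : ∑ z, P z * (Real.log (P z / Q z) - relEnt P Q) = 0 := by
  simp_rw [mul_sub]
  rw [sum_sub_distrib, ← sum_mul, hP.2, one_mul]
  exact sub_self _

/-- Chebyshev's inequality for the information spectrum divergence, with an arbitrary centre `m`
and an arbitrary bound `v` on the second moment of `log (P/Q)` about `m`. -/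
lemma Ds_le_add_sqrt {Z : Type*} [Fintype Z] {P Q : Z → ℝ} (hP : IsDist P)
    (hdom : ∀ z, 0 < P z → 0 < Q z) {ε m v : ℝ} (hε : ε < 1)
    (hmv : ∑ z, P z * (Real.log (P z / Q z) - m) ^ 2 ≤ v) :
    Ds ε P Q ≤ ((m + Real.sqrt (v / (1 - ε)) : ℝ) : EReal) := by
  refine sSup_le ?_
  rintro _ ⟨R, hR, rfl⟩
  rw [Set.mem_ofPred_eq] at hR
  refine EReal.coe_le_coe_iff.2 (not_lt.1 fun hlt => ?_)
  have hε' : 0 < 1 - ε := sub_pos.2 hε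
  have hsqrt : Real.sqrt (v / (1 - ε)) < R - m := by linarith
  have ht : 0 < R - m := (Real.sqrt_nonneg _).trans_lt hsqrt
  have hv : v < (R - m) ^ 2 * (1 - ε) := (div_lt_iff₀ hε').1 ((Real.sqrt_lt' ht).1 hsqrt)
  have hterm : ∀ z, (R - m) ^ 2 *
      (P z - if P z = 0 ∨ (0 < Q z ∧ Real.log (P z / Q z) ≤ R) then P z else 0) ≤
      P z * (Real.log (P z / Q z) - m) ^ 2 := by
    intro z
    split_ifs with h
    · rw [sub_self, mul_zero]
      exact mul_nonneg (hP.1 z) (sq_nonneg _)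
    · push Not at h
      have hlog := h.2 (hdom z (lt_of_le_of_ne (hP.1 z) h.1.symm))
      rw [sub_zero, mul_comm]
      exact mul_le_mul_of_nonneg_left (pow_le_pow_left₀ ht.le (by linarith) 2) (hP.1 z)
  have hsum := sum_le_sum fun z (_ : z ∈ univ) => hterm z
  rw [← mul_sum, sum_sub_distrib, hP.2] at hsum
  have := mul_le_mul_of_nonneg_left (sub_le_sub_left hR 1) (sq_nonneg (R - m))
  linarith

/-- Chebyshev-type bound on the information spectrum divergence of a
product of distributions `P_{i_1} × ⋯ × P_{i_n}` against `Q^{×n}`: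
`D_s^ε ≤ n D_n + √(n V_n / (1-ε))`. -/
theorem Ds_product_chebyshev
    {I Z : Type*} [Fintype I] [Fintype Z]
    (Q : Z → ℝ) (hQ : IsDist Q) (Pd : I → Z → ℝ) (hPd : ∀ i, IsDist (Pd i))
    (hdom : ∀ i z, 0 < Pd i z → 0 < Q z)
    (n : ℕ) (hn : 1 ≤ n) (idx : Fin n → I) (ε : ℝ) (hε : ε ∈ Set.Ioo (0 : ℝ) 1) :
    Ds ε (fun zs : Fin n → Z => ∏ k, Pd (idx k) (zs k))
        (fun zs : Fin n → Z => ∏ k, Q (zs k)) ≤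
      (((n : ℝ) * ((1 / (n : ℝ)) * ∑ k : Fin n, relEnt (Pd (idx k)) Q)
          + Real.sqrt ((n : ℝ) * ((1 / (n : ℝ)) * ∑ k : Fin n, divVar (Pd (idx k)) Q)
              / (1 - ε)) : ℝ) : EReal) := by
  have hn0 : (n : ℝ) ≠ 0 := by positivity
  rw [← mul_assoc, ← mul_assoc, mul_one_div_cancel hn0, one_mul, one_mul]
  refine Ds_le_add_sqrt (IsDist.prod fun k => hPd (idx k)) (fun zs hzs => ?_) hε.2 (le_of_eq ?_)
  · refine prod_pos fun k _ => hdom (idx k) _ (lt_of_le_of_ne ((hPd _).1 _) ?_)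
    exact (prod_ne_zero_iff.1 hzs.ne' k (mem_univ k)).symm
  · rw [show ∑ k, divVar (Pd (idx k)) Q = _ from (sum_prod_mul_sum_sq (fun k => Pd (idx k))
      (fun k z => Real.log (Pd (idx k) z / Q z) - relEnt (Pd (idx k)) Q)
      (fun k => (hPd _).2) (fun k => (hPd _).sum_mul_log_sub_relEnt Q)).symm]
    refine sum_congr rfl fun zs _ => ?_
    rcases eq_or_ne (∏ k, Pd (idx k) (zs k)) 0 with hzero | hne
    · simp [hzero]
    · have hpos : ∀ k, Pd (idx k) (zs k) ≠ 0 := fun k => prod_ne_zero_iff.1 hne k (mem_univ k)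
      have hQpos : ∀ k, 0 < Q (zs k) := fun k =>
        hdom (idx k) _ (lt_of_le_of_ne ((hPd _).1 _) (hpos k).symm)
      rw [← prod_div_distrib,
        Real.log_prod fun k _ => div_ne_zero (hpos k) (hQpos k).ne', sum_sub_distrib]
end
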